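/- arXiv:1908.09584 — 4 statements merged into one kernel-verified Lean document; each statement's English description precedes it below -/
import Mathlib

section
/- For nonempty tuples H = (H_1,…,H_N) and G = (G_1,…,G_M), writing H' = (H_1,…,H_{N−1}) and G' = (G_1,…,G_{M−1}), the reading-order-constrained distance satisfies the recurrence LD^R(H,G) = min{ LD^R(H',G') + LD(H_N,G_M); LD^R(H',G) + |H_N|; LD^R(H,G') + |G_M| }. -/
/-- The Levenshtein distance between two lists: the minimal number of single-character
insertions, deletions and substitutions transforming the first list into the second. -/
def lev {α : Type*} [DecidableEq α] : List α → List α → ℕ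
  | [], ys => ys.length
  | x :: xs, [] => (x :: xs).length
  | x :: xs, y :: ys =>
      min (lev xs ys + if x = y then 0 else 1)
        (min (lev xs (y :: ys) + 1) (lev (x :: xs) ys + 1))
  termination_by xs ys => xs.length + ys.length

/-- `A ∈ 𝒜`: a `{0,1}`-valued `N × M` matrix in which every row and every column
contains at most one `1`. -/
def ValidA {N M : ℕ} (A : Fin N → Fin M → Bool) : Prop :=
  (∀ y x x', A y x = true → A y x' = true → x = x') ∧
  (∀ y y' x, A y x = true → A y' x = true → y = y')

/-- The reading-order condition defining `𝒜^R ⊆ 𝒜`: whenever `A_{y,x} = A_{y',x'} = 1`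
and `y < y'`, then `x < x'`. -/
def ReadOrder {N M : ℕ} (A : Fin N → Fin M → Bool) : Prop :=
  ∀ y y' x x', A y x = true → A y' x' = true → y < y' → x < x'

/-- The cost `Σ_{(y,x)∈W(A)} LD(H_y,G_x) + Σ_{y∈U(A)} |H_y| + Σ_{x∈V(A)} |G_x|`
associated with an assignment matrix `A` between the tuples of lines `H` and `G`. -/
def costA {α : Type*} [DecidableEq α] (H G : List (List α))
    (A : Fin H.length → Fin G.length → Bool) : ℕ :=
  (∑ p : Fin H.length × Fin G.length, if A p.1 p.2 = true then lev (H.get p.1) (G.get p.2) else 0)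
  + (∑ y : Fin H.length, if ∀ x, ¬ A y x = true then (H.get y).length else 0)
  + (∑ x : Fin G.length, if ∀ y, ¬ A y x = true then (G.get x).length else 0)

/-- `LD^R(H,G)`: the minimum of the cost over all valid assignment matrices that
respect the reading order. -/
noncomputable def LDR {α : Type*} [DecidableEq α] (H G : List (List α)) : ℕ :=
  sInf {c : ℕ | ∃ A : Fin H.length → Fin G.length → Bool,
    ValidA A ∧ ReadOrder A ∧ c = costA H G A}

/-- The cost of an assignment `A` with pairing weights `w`, and costs `u`, `v` for unmatched
rows and columns. -/
def assignCost {N M : ℕ} (w : Fin N → Fin M → ℕ) (u : Fin N → ℕ) (v : Fin M → ℕ)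
    (A : Fin N → Fin M → Bool) : ℕ :=
  (∑ p : Fin N × Fin M, if A p.1 p.2 = true then w p.1 p.2 else 0)
  + (∑ y : Fin N, if ∀ x, ¬ A y x = true then u y else 0)
  + (∑ x : Fin M, if ∀ y, ¬ A y x = true then v x else 0)

/-- The least cost of an order-preserving assignment. -/
noncomputable def minAssignCost {N M : ℕ} (w : Fin N → Fin M → ℕ) (u : Fin N → ℕ)
    (v : Fin M → ℕ) : ℕ :=
  sInf {c : ℕ | ∃ A : Fin N → Fin M → Bool, ValidA A ∧ ReadOrder A ∧ c = assignCost w u v A}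

section Assignment

variable {N M : ℕ}

lemma minAssignCost_le {w : Fin N → Fin M → ℕ} {u : Fin N → ℕ} {v : Fin M → ℕ}
    {A : Fin N → Fin M → Bool} (hV : ValidA A) (hR : ReadOrder A) :
    minAssignCost w u v ≤ assignCost w u v A :=
  Nat.sInf_le ⟨A, hV, hR, rfl⟩

lemma exists_minAssignCost_eq (w : Fin N → Fin M → ℕ) (u : Fin N → ℕ) (v : Fin M → ℕ) :
    ∃ A, ValidA A ∧ ReadOrder A ∧ minAssignCost w u v = assignCost w u v A :=
  Nat.sInf_mem (s := {c | ∃ A, ValidA A ∧ ReadOrder A ∧ c = assignCost w u v A})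
    ⟨_, fun _ _ => false, by simp [ValidA], by simp [ReadOrder], rfl⟩

lemma assignCost_of_last_row_eq_false (w : Fin (N + 1) → Fin M → ℕ) (u : Fin (N + 1) → ℕ)
    (v : Fin M → ℕ) {A : Fin (N + 1) → Fin M → Bool} (h : ∀ x, A (Fin.last N) x = false) :
    assignCost w u v A =
      assignCost (fun y => w y.castSucc) (fun y => u y.castSucc) v (fun y => A y.castSucc)
        + u (Fin.last N) := by
  simp only [assignCost, Fintype.sum_prod_type, Fin.sum_univ_castSucc, Fin.forall_fin_succ', h]
  simp
  omega

lemma assignCost_of_last_col_eq_false (w : Fin N → Fin (M + 1) → ℕ) (u : Fin N → ℕ)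
    (v : Fin (M + 1) → ℕ) {A : Fin N → Fin (M + 1) → Bool} (h : ∀ y, A y (Fin.last M) = false) :
    assignCost w u v A =
      assignCost (fun y x => w y x.castSucc) u (fun x => v x.castSucc) (fun y x => A y x.castSucc)
        + v (Fin.last M) := by
  simp only [assignCost, Fintype.sum_prod_type, Fin.sum_univ_castSucc, Fin.forall_fin_succ', h]
  simp
  omega

lemma assignCost_of_last_last (w : Fin (N + 1) → Fin (M + 1) → ℕ) (u : Fin (N + 1) → ℕ)
    (v : Fin (M + 1) → ℕ) {A : Fin (N + 1) → Fin (M + 1) → Bool}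
    (h : A (Fin.last N) (Fin.last M) = true)
    (hrow : ∀ x : Fin M, A (Fin.last N) x.castSucc = false)
    (hcol : ∀ y : Fin N, A y.castSucc (Fin.last M) = false) :
    assignCost w u v A =
      assignCost (fun y x => w y.castSucc x.castSucc) (fun y => u y.castSucc)
        (fun x => v x.castSucc) (fun y x => A y.castSucc x.castSucc)
        + w (Fin.last N) (Fin.last M) := by
  simp only [assignCost, Fintype.sum_prod_type, Fin.sum_univ_castSucc, Fin.forall_fin_succ', h,
    hrow, hcol]
  simp
  omega

lemma minAssignCost_le_last_row (w : Fin (N + 1) → Fin M → ℕ) (u : Fin (N + 1) → ℕ)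
    (v : Fin M → ℕ) :
    minAssignCost w u v ≤
      minAssignCost (fun y => w y.castSucc) (fun y => u y.castSucc) v + u (Fin.last N) := by
  obtain ⟨A, hV, hR, hA⟩ :=
    exists_minAssignCost_eq (fun y => w y.castSucc) (fun y => u y.castSucc) v
  let B : Fin (N + 1) → Fin M → Bool := fun y x => Fin.lastCases false (fun y' => A y' x) y
  have hB : assignCost w u v B = _ := assignCost_of_last_row_eq_false w u v (by simp [B])
  simp only [B, Fin.lastCases_castSucc] at hB
  rw [hA, ← hB]
  refine minAssignCost_le ⟨?_, ?_⟩ ?_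
  · simpa [Fin.forall_fin_succ'] using hV.1
  · simpa [Fin.forall_fin_succ'] using hV.2
  · simpa [ReadOrder, Fin.forall_fin_succ'] using hR

lemma minAssignCost_le_last_col (w : Fin N → Fin (M + 1) → ℕ) (u : Fin N → ℕ)
    (v : Fin (M + 1) → ℕ) :
    minAssignCost w u v ≤
      minAssignCost (fun y x => w y x.castSucc) u (fun x => v x.castSucc) + v (Fin.last M) := by
  obtain ⟨A, hV, hR, hA⟩ :=
    exists_minAssignCost_eq (fun y x => w y x.castSucc) u (fun x => v x.castSucc)
  let B : Fin N → Fin (M + 1) → Bool := fun y x => Fin.lastCases false (fun x' => A y x') x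
  have hB : assignCost w u v B = _ := assignCost_of_last_col_eq_false w u v (by simp [B])
  simp only [B, Fin.lastCases_castSucc] at hB
  rw [hA, ← hB]
  refine minAssignCost_le ⟨?_, ?_⟩ ?_
  · simpa [Fin.forall_fin_succ'] using hV.1
  · simpa [Fin.forall_fin_succ'] using hV.2
  · simpa [ReadOrder, Fin.forall_fin_succ'] using hR

lemma minAssignCost_le_last_last (w : Fin (N + 1) → Fin (M + 1) → ℕ) (u : Fin (N + 1) → ℕ)
    (v : Fin (M + 1) → ℕ) :
    minAssignCost w u v ≤
      minAssignCost (fun y x => w y.castSucc x.castSucc) (fun y => u y.castSucc)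
        (fun x => v x.castSucc) + w (Fin.last N) (Fin.last M) := by
  obtain ⟨A, hV, hR, hA⟩ := exists_minAssignCost_eq (fun y x => w y.castSucc x.castSucc)
    (fun y => u y.castSucc) (fun x => v x.castSucc)
  let B : Fin (N + 1) → Fin (M + 1) → Bool := fun y x =>
    Fin.lastCases (Fin.lastCases true (fun _ => false) x)
      (fun y' => Fin.lastCases false (fun x' => A y' x') x) y
  have hB : assignCost w u v B = _ :=
    assignCost_of_last_last w u v (by simp [B]) (by simp [B]) (by simp [B])
  simp only [B, Fin.lastCases_castSucc] at hB
  rw [hA, ← hB]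
  refine minAssignCost_le ⟨?_, ?_⟩ ?_
  · simpa [Fin.forall_fin_succ'] using hV.1
  · simpa [Fin.forall_fin_succ'] using hV.2
  · simpa [ReadOrder, Fin.forall_fin_succ', Fin.le_last] using hR

theorem minAssignCost_succ (w : Fin (N + 1) → Fin (M + 1) → ℕ) (u : Fin (N + 1) → ℕ)
    (v : Fin (M + 1) → ℕ) :
    minAssignCost w u v =
      min (minAssignCost (fun y x => w y.castSucc x.castSucc) (fun y => u y.castSucc)
          (fun x => v x.castSucc) + w (Fin.last N) (Fin.last M))
        (min (minAssignCost (fun y => w y.castSucc) (fun y => u y.castSucc) v + u (Fin.last N))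
          (minAssignCost (fun y x => w y x.castSucc) u (fun x => v x.castSucc)
            + v (Fin.last M))) := by
  refine le_antisymm (le_min (minAssignCost_le_last_last w u v)
    (le_min (minAssignCost_le_last_row w u v) (minAssignCost_le_last_col w u v))) ?_
  obtain ⟨A, hV, hR, hA⟩ := exists_minAssignCost_eq w u v
  rw [hA]
  by_cases hrow : ∀ x, A (Fin.last N) x = false
  · rw [assignCost_of_last_row_eq_false w u v hrow]
    refine (min_le_right _ _).trans <| (min_le_left _ _).trans <|
      Nat.add_le_add_right (minAssignCost_le ⟨?_, ?_⟩ ?_) _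
    · exact fun y => hV.1 y.castSucc
    · exact fun y y' x h h' => Fin.castSucc_injective _ (hV.2 _ _ x h h')
    · exact fun y y' x x' h h' hlt => hR _ _ x x' h h' (Fin.castSucc_lt_castSucc_iff.2 hlt)
  by_cases hcol : ∀ y, A y (Fin.last M) = false
  · rw [assignCost_of_last_col_eq_false w u v hcol]
    refine (min_le_right _ _).trans <| (min_le_right _ _).trans <|
      Nat.add_le_add_right (minAssignCost_le ⟨?_, ?_⟩ ?_) _
    · exact fun y x x' h h' => Fin.castSucc_injective _ (hV.1 y _ _ h h')
    · exact fun y y' x => hV.2 y y' x.castSucc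
    · exact fun y y' x x' h h' hlt => Fin.castSucc_lt_castSucc_iff.1 (hR y y' _ _ h h' hlt)
  simp only [not_forall, Bool.not_eq_false] at hrow hcol
  obtain ⟨x, hx⟩ := hrow
  obtain ⟨y, hy⟩ := hcol
  obtain rfl : y = Fin.last N := by
    by_contra hne
    exact absurd (hR _ _ _ _ hy hx (Fin.lt_last_iff_ne_last.2 hne)) (Fin.le_last x).not_gt
  rw [assignCost_of_last_last w u v hy
    (fun x => Bool.eq_false_iff.2 fun h => (Fin.castSucc_lt_last x).ne (hV.1 _ _ _ h hy))
    (fun y => Bool.eq_false_iff.2 fun h => (Fin.castSucc_lt_last y).ne (hV.2 _ _ _ h hy))]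
  refine (min_le_left _ _).trans <| Nat.add_le_add_right (minAssignCost_le ⟨?_, ?_⟩ ?_) _
  · exact fun y x x' h h' => Fin.castSucc_injective _ (hV.1 _ _ _ h h')
  · exact fun y y' x h h' => Fin.castSucc_injective _ (hV.2 _ _ _ h h')
  · exact fun y y' x x' h h' hlt =>
      Fin.castSucc_lt_castSucc_iff.1 (hR _ _ _ _ h h' (Fin.castSucc_lt_castSucc_iff.2 hlt))

end Assignment

lemma LDR_eq_minAssignCost {α : Type*} [DecidableEq α] {N M : ℕ} (H G : List (List α))
    (hN : N = H.length) (hM : M = G.length) :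
    LDR H G = minAssignCost (fun (y : Fin N) (x : Fin M) => lev H[y] G[x])
      (fun y => H[y].length) (fun x => G[x].length) := by
  subst hN hM
  rfl

/-- For nonempty tuples `H = (H_1,…,H_N)` and `G = (G_1,…,G_M)`, writing
`H' = (H_1,…,H_{N−1})` and `G' = (G_1,…,G_{M−1})`, the reading-order-constrained distance
satisfies the recurrence
`LD^R(H,G) = min{ LD^R(H',G') + LD(H_N,G_M); LD^R(H',G) + |H_N|; LD^R(H,G') + |G_M| }`. -/
theorem LDR_recurrence {α : Type*} [DecidableEq α]
    (H' G' : List (List α)) (a b : List α) :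
    LDR (H' ++ [a]) (G' ++ [b])
      = min (LDR H' G' + lev a b)
          (min (LDR H' (G' ++ [b]) + a.length) (LDR (H' ++ [a]) G' + b.length)) := by
  rw [LDR_eq_minAssignCost (H' ++ [a]) (G' ++ [b]) (N := H'.length + 1) (M := G'.length + 1)
      (by simp) (by simp), minAssignCost_succ,
    LDR_eq_minAssignCost H' G' rfl rfl,
    LDR_eq_minAssignCost H' (G' ++ [b]) (M := G'.length + 1) rfl (by simp),
    LDR_eq_minAssignCost (H' ++ [a]) G' (N := H'.length + 1) (by simp) rfl]
  simp
end

section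
/- For nonempty tuples H and G with flattened sequences h = f(H), g = f(G) and with H' = (H_1,…,H_{N−1}), G' = (G_1,…,G_{M−1}), the dynamic program decomposes at the penultimate separators: D^R(|h|−1, |g|−1) = LD^R(H',G') + LD(H_N, G_M). -/
open scoped Classical

/-- The flatten function `f`: the separator `↵ ∉ Σ` is modelled by `none`, characters of
`Σ = α` by `some a`; a separator is written before, between and after the lines. -/
def flat {α : Type*} (H : List (List α)) : List (Option α) :=
  none :: H.flatMap (fun l => l.map some ++ [none])

/-- `h_i`, the `i`-th symbol (1-indexed) of a flattened sequence. -/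
def nth {α : Type*} (h : List (Option α)) (i : ℕ) : Option α :=
  h.getD (i - 1) none

/-- `i` is a line-break position of `h` (1-indexed): `h_i = ↵`. -/
def isBrk {α : Type*} (h : List (Option α)) (i : ℕ) : Prop :=
  1 ≤ i ∧ i ≤ h.length ∧ nth h i = none

/-- `b_h^{y-1}` for `i = b_h^y`: the largest break position strictly below `i`
(`0` if there is none). -/
noncomputable def prevBrk {α : Type*} (h : List (Option α)) (i : ℕ) : ℕ :=
  Nat.findGreatest (fun k => isBrk h k) (i - 1)

/-- The index `y` such that `i = b_h^y` (the number of break positions `≤ i`). -/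
noncomputable def brkIdx {α : Type*} (h : List (Option α)) (i : ℕ) : ℕ :=
  ((List.range i).filter (fun k => decide (isBrk h (k + 1)))).length

/-- `d^R(i,j)`: `0` if `h_i = g_j`; `1` if `h_i ≠ g_j` and both `h_i, g_j ∈ Σ`;
`∞` otherwise. -/
noncomputable def dR {α : Type*} (h g : List (Option α)) (i j : ℕ) : ℕ∞ :=
  if nth h i = nth g j then 0
  else if nth h i ≠ none ∧ nth g j ≠ none then 1
  else ⊤

/-- The dynamic program `D^R(i,j)` for `h = f(H)` and `g = f(G)`:
`D^R(0,0) = 0`, `D^R(i,0) = i`, `D^R(0,j) = j`; at pairs of break positions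
`(i,j) = (b_h^y, b_g^x)`,
`D^R(i,j) = min{ D^R(i−1,j−1); D^R(b_h^{y−1},j) + |H_{y−1}| if y ≥ 2;
D^R(i,b_g^{x−1}) + |G_{x−1}| if x ≥ 2 }`; at all other pairs,
`D^R(i,j) = min{ D^R(i−1,j−1) + d^R(i,j); D^R(i−1,j) + 1 if h_i ≠ ↵;
D^R(i,j−1) + 1 if g_j ≠ ↵ }`. -/
noncomputable def DR {α : Type*} (H G : List (List α)) : ℕ → ℕ → ℕ∞
  | 0, 0 => 0
  | i + 1, 0 => (i + 1 : ℕ)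
  | 0, j + 1 => (j + 1 : ℕ)
  | i + 1, j + 1 =>
    if isBrk (flat H) (i + 1) ∧ isBrk (flat G) (j + 1) then
      min (DR H G i j) <| min
        (if 2 ≤ brkIdx (flat H) (i + 1) then
            DR H G (prevBrk (flat H) (i + 1)) (j + 1)
              + ((H.getD (brkIdx (flat H) (i + 1) - 2) []).length : ℕ∞)
          else ⊤)
        (if 2 ≤ brkIdx (flat G) (j + 1) then
            DR H G (i + 1) (prevBrk (flat G) (j + 1))
              + ((G.getD (brkIdx (flat G) (j + 1) - 2) []).length : ℕ∞)
          else ⊤)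
    else
      min (DR H G i j + dR (flat H) (flat G) (i + 1) (j + 1)) <| min
        (if nth (flat H) (i + 1) ≠ none then DR H G i (j + 1) + 1 else ⊤)
        (if nth (flat G) (j + 1) ≠ none then DR H G (i + 1) j + 1 else ⊤)
  termination_by i j => i + j
  decreasing_by
  · omega
  · have := Nat.findGreatest_le (P := fun k => isBrk (flat H) k) (i + 1 - 1)
    unfold prevBrk
    omega
  · have := Nat.findGreatest_le (P := fun k => isBrk (flat G) k) (j + 1 - 1)
    unfold prevBrk
    omega
  · omega
  · omega
  · omega

/-- `EditPath xs ys n`: the lines `xs` and `ys` can be aligned at cost exactly `n`, each insertion,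
deletion and substitution costing `1`. -/
inductive EditPath {α : Type*} [DecidableEq α] : List α → List α → ℕ → Prop
  | nil : EditPath [] [] 0
  | sub {xs ys n} (x y : α) (h : EditPath xs ys n) :
      EditPath (x :: xs) (y :: ys) (n + if x = y then 0 else 1)
  | del {xs ys n} (x : α) (h : EditPath xs ys n) : EditPath (x :: xs) ys (n + 1)
  | ins {xs ys n} (y : α) (h : EditPath xs ys n) : EditPath xs (y :: ys) (n + 1)

section Levenshtein

variable {α : Type*} [DecidableEq α]

theorem lev_nil_left (ys : List α) : lev [] ys = ys.length := by
  rw [lev.eq_def]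

theorem lev_nil_right (xs : List α) : lev xs [] = xs.length := by
  cases xs <;> rw [lev.eq_def]

theorem lev_cons_cons (x y : α) (xs ys : List α) :
    lev (x :: xs) (y :: ys) = min (lev xs ys + if x = y then 0 else 1)
      (min (lev xs (y :: ys) + 1) (lev (x :: xs) ys + 1)) := by
  rw [lev.eq_def]

theorem editPath_lev (xs ys : List α) : EditPath xs ys (lev xs ys) := by
  induction xs generalizing ys with
  | nil =>
    rw [lev_nil_left]
    induction ys with
    | nil => exact .nil
    | cons y ys ih => exact .ins y ih
  | cons x xs ihx =>
    induction ys with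
    | nil =>
      have := EditPath.del x (ihx [])
      simpa [lev_nil_right] using this
    | cons y ys ihy =>
      rw [lev_cons_cons]
      rcases min_choice (lev xs ys + if x = y then 0 else 1)
        (min (lev xs (y :: ys) + 1) (lev (x :: xs) ys + 1)) with h | h
      · rw [h]
        exact .sub x y (ihx ys)
      · rw [h]
        rcases min_choice (lev xs (y :: ys) + 1) (lev (x :: xs) ys + 1) with h | h
        · rw [h]
          exact .del x (ihx _)
        · rw [h]
          exact .ins y ihy

theorem lev_cons_left_le (x : α) (xs ys : List α) : lev (x :: xs) ys ≤ lev xs ys + 1 := by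
  cases ys with
  | nil => simp [lev_nil_right]
  | cons y ys => rw [lev_cons_cons]; omega

theorem lev_cons_right_le (y : α) (xs ys : List α) : lev xs (y :: ys) ≤ lev xs ys + 1 := by
  cases xs with
  | nil => simp [lev_nil_left]
  | cons x xs => rw [lev_cons_cons]; omega

theorem EditPath.lev_le {xs ys : List α} {n : ℕ} (h : EditPath xs ys n) : lev xs ys ≤ n := by
  induction h with
  | nil => simp [lev_nil_left]
  | sub x y h ih => rw [lev_cons_cons]; omega
  | del x h ih => exact (lev_cons_left_le _ _ _).trans (by omega)
  | ins y h ih => exact (lev_cons_right_le _ _ _).trans (by omega)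

theorem EditPath.append {xs ys xs' ys' : List α} {n n' : ℕ} (h : EditPath xs ys n)
    (h' : EditPath xs' ys' n') : EditPath (xs ++ xs') (ys ++ ys') (n + n') := by
  induction h with
  | nil => simpa using h'
  | sub x y h ih => rw [add_right_comm]; exact .sub x y ih
  | del x h ih => rw [add_right_comm]; exact .del x ih
  | ins y h ih => rw [add_right_comm]; exact .ins y ih

theorem EditPath.reverse {xs ys : List α} {n : ℕ} (h : EditPath xs ys n) :
    EditPath xs.reverse ys.reverse n := by
  induction h with
  | nil => exact .nil
  | sub x y h ih =>
    simpa using ih.append (.sub x y .nil)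
  | del x h ih => simpa using ih.append (.del x .nil)
  | ins y h ih => simpa using ih.append (.ins y .nil)

theorem lev_reverse (xs ys : List α) : lev xs.reverse ys.reverse = lev xs ys := by
  refine le_antisymm (editPath_lev xs ys).reverse.lev_le ?_
  simpa using (editPath_lev xs.reverse ys.reverse).reverse.lev_le

theorem lev_concat_concat (x y : α) (xs ys : List α) :
    lev (xs ++ [x]) (ys ++ [y]) = min (lev xs ys + if x = y then 0 else 1)
      (min (lev xs (ys ++ [y]) + 1) (lev (xs ++ [x]) ys + 1)) := by
  rw [← lev_reverse (xs ++ [x]), ← lev_reverse xs ys, ← lev_reverse xs (ys ++ [y]),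
    ← lev_reverse (xs ++ [x]) ys]
  simp [lev_cons_cons]

end Levenshtein

/-- The recursive form of `LDR`, on the first `n` lines of `h` and the first `m` lines of `g`. -/
def lineDist {α : Type*} [DecidableEq α] (h g : ℕ → List α) : ℕ → ℕ → ℕ
  | 0, 0 => 0
  | n + 1, 0 => lineDist h g n 0 + (h n).length
  | 0, m + 1 => lineDist h g 0 m + (g m).length
  | n + 1, m + 1 => min (lineDist h g n m + lev (h n) (g m))
      (min (lineDist h g n (m + 1) + (h n).length) (lineDist h g (n + 1) m + (g m).length))

/-- A monotone partial matching between `{0,…,n-1}` and `{0,…,m-1}`. -/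
structure IsMonotoneMatching (n m : ℕ) (A : ℕ → ℕ → Prop) : Prop where
  lt_left : ∀ {y x}, A y x → y < n
  lt_right : ∀ {y x}, A y x → x < m
  left_unique : ∀ {y x x'}, A y x → A y x' → x = x'
  right_unique : ∀ {y y' x}, A y x → A y' x → y = y'
  mono : ∀ {y y' x x'}, A y x → A y' x' → y < y' → x < x'

/-- The cost of a matching, between the first `n` lines of `h` and the first `m` lines of `g`. -/
noncomputable def matchingCost {α : Type*} [DecidableEq α] (h g : ℕ → List α) (n m : ℕ)
    (A : ℕ → ℕ → Prop) : ℕ :=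
  (∑ y ∈ Finset.range n, ∑ x ∈ Finset.range m, if A y x then lev (h y) (g x) else 0)
  + (∑ y ∈ Finset.range n, if ∀ x, ¬ A y x then (h y).length else 0)
  + (∑ x ∈ Finset.range m, if ∀ y, ¬ A y x then (g x).length else 0)

section Matching

variable {α : Type*} [DecidableEq α] {h g : ℕ → List α} {n m : ℕ} {A : ℕ → ℕ → Prop}

theorem matchingCost_succ_left (hA : ∀ x, ¬ A n x) :
    matchingCost h g (n + 1) m A = matchingCost h g n m A + (h n).length := by
  simp only [matchingCost, Finset.sum_range_succ, hA]
  simp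
  omega

theorem matchingCost_succ_right (hA : ∀ y, ¬ A y m) :
    matchingCost h g n (m + 1) A = matchingCost h g n m A + (g m).length := by
  simp only [matchingCost, Finset.sum_range_succ, hA]
  simp
  omega

theorem IsMonotoneMatching.insert (hA : IsMonotoneMatching n m A) :
    IsMonotoneMatching (n + 1) (m + 1) (fun y x => A y x ∨ (y = n ∧ x = m)) := by
  obtain ⟨h1, h2, h3, h4, h5⟩ := hA
  constructor <;> grind

theorem matchingCost_insert (hA : IsMonotoneMatching n m A) :
    matchingCost h g (n + 1) (m + 1) (fun y x => A y x ∨ (y = n ∧ x = m))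
      = matchingCost h g n m A + lev (h n) (g m) := by
  have h1 : ∀ x, ¬ A n x := fun x hx => lt_irrefl _ (hA.lt_left hx)
  have h2 : ∀ y, ¬ A y m := fun y hy => lt_irrefl _ (hA.lt_right hy)
  obtain ⟨B, hB⟩ : ∃ B : ℕ → ℕ → Prop, B = fun y x => A y x ∨ (y = n ∧ x = m) := ⟨_, rfl⟩
  rw [← hB]
  replace hB : ∀ y x, B y x ↔ A y x ∨ (y = n ∧ x = m) := by simp [hB]
  have e1 : ∀ y ∈ Finset.range n, ∀ x, B y x ↔ A y x := by
    intro y hy x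
    have := Finset.mem_range.1 hy
    grind
  have e2 : ∀ x ∈ Finset.range m, ∀ y, B y x ↔ A y x := by
    intro x hx y
    have := Finset.mem_range.1 hx
    grind
  have s1 : (∑ y ∈ Finset.range n, ∑ x ∈ Finset.range (m + 1),
      if B y x then lev (h y) (g x) else 0)
      = ∑ y ∈ Finset.range n, ∑ x ∈ Finset.range m, if A y x then lev (h y) (g x) else 0 := by
    refine Finset.sum_congr rfl fun y hy => ?_
    rw [Finset.sum_range_succ, if_neg (by rw [e1 y hy]; exact h2 y), add_zero]
    simp only [e1 y hy]
  have s2 : (∑ y ∈ Finset.range n, if ∀ x, ¬ B y x then (h y).length else 0)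
      = ∑ y ∈ Finset.range n, if ∀ x, ¬ A y x then (h y).length else 0 :=
    Finset.sum_congr rfl fun y hy => by simp only [e1 y hy]
  have s3 : (∑ x ∈ Finset.range m, if ∀ y, ¬ B y x then (g x).length else 0)
      = ∑ x ∈ Finset.range m, if ∀ y, ¬ A y x then (g x).length else 0 :=
    Finset.sum_congr rfl fun x hx => by simp only [e2 x hx]
  have s4 : (∑ x ∈ Finset.range (m + 1), if B n x then lev (h n) (g x) else 0)
      = lev (h n) (g m) := by
    rw [Finset.sum_range_succ, Finset.sum_eq_zero]
    · simp [hB]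
    · intro x hx
      rw [if_neg]
      rw [e2 x hx]
      exact h1 x
  have t1 : ¬ ∀ x, ¬ B n x := fun H => H m ((hB _ _).2 (Or.inr ⟨rfl, rfl⟩))
  have t2 : ¬ ∀ y, ¬ B y m := fun H => H n ((hB _ _).2 (Or.inr ⟨rfl, rfl⟩))
  unfold matchingCost
  rw [Finset.sum_range_succ _ n, Finset.sum_range_succ _ n,
    Finset.sum_range_succ (fun x => if ∀ y, ¬ B y x then (g x).length else 0) m,
    s1, s2, s3, s4, if_neg t1, if_neg t2]
  omega

theorem IsMonotoneMatching.of_row_empty (hA : IsMonotoneMatching (n + 1) m A)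
    (hn : ∀ x, ¬ A n x) : IsMonotoneMatching n m A := by
  obtain ⟨h1, h2, h3, h4, h5⟩ := hA
  constructor <;> grind

theorem IsMonotoneMatching.of_col_empty (hA : IsMonotoneMatching n (m + 1) A)
    (hm : ∀ y, ¬ A y m) : IsMonotoneMatching n m A := by
  obtain ⟨h1, h2, h3, h4, h5⟩ := hA
  constructor <;> grind

theorem IsMonotoneMatching.mono_left (hA : IsMonotoneMatching n m A) :
    IsMonotoneMatching (n + 1) m A := by
  obtain ⟨h1, h2, h3, h4, h5⟩ := hA
  constructor <;> grind

theorem IsMonotoneMatching.mono_right (hA : IsMonotoneMatching n m A) :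
    IsMonotoneMatching n (m + 1) A := by
  obtain ⟨h1, h2, h3, h4, h5⟩ := hA
  constructor <;> grind

theorem IsMonotoneMatching.row_not (hA : IsMonotoneMatching n m A) (x : ℕ) : ¬ A n x :=
  fun hx => lt_irrefl _ (hA.lt_left hx)

theorem IsMonotoneMatching.col_not (hA : IsMonotoneMatching n m A) (y : ℕ) : ¬ A y m :=
  fun hy => lt_irrefl _ (hA.lt_right hy)

theorem IsMonotoneMatching.erase (hA : IsMonotoneMatching (n + 1) (m + 1) A) (hnm : A n m) :
    IsMonotoneMatching n m (fun y x => A y x ∧ ¬ (y = n ∧ x = m)) := by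
  obtain ⟨h1, h2, h3, h4, h5⟩ := hA
  constructor <;> grind

theorem exists_matchingCost_eq (h g : ℕ → List α) (n m : ℕ) :
    ∃ A, IsMonotoneMatching n m A ∧ matchingCost h g n m A = lineDist h g n m := by
  fun_induction lineDist h g n m with
  | case1 =>
    refine ⟨fun _ _ => False, ⟨?_, ?_, ?_, ?_, ?_⟩, ?_⟩ <;> simp [matchingCost]
  | case2 n ih =>
    obtain ⟨A, hA, e⟩ := ih
    exact ⟨A, hA.mono_left, by rw [matchingCost_succ_left hA.row_not, e]⟩
  | case3 m ih =>
    obtain ⟨A, hA, e⟩ := ih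
    exact ⟨A, hA.mono_right, by rw [matchingCost_succ_right hA.col_not, e]⟩
  | case4 n m ih1 ih2 ih3 =>
    obtain ⟨A, hA, eA⟩ := ih1
    obtain ⟨B, hB, eB⟩ := ih2
    obtain ⟨C, hC, eC⟩ := ih3
    rw [← eA, ← eB, ← eC, ← matchingCost_insert hA, ← matchingCost_succ_left hB.row_not,
      ← matchingCost_succ_right hC.col_not]
    rcases min_choice (matchingCost h g (n + 1) (m + 1) fun y x => A y x ∨ (y = n ∧ x = m))
      (min (matchingCost h g (n + 1) (m + 1) B) (matchingCost h g (n + 1) (m + 1) C)) with e | e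
    · exact ⟨_, hA.insert, e.symm⟩
    · rcases min_choice (matchingCost h g (n + 1) (m + 1) B)
        (matchingCost h g (n + 1) (m + 1) C) with e' | e'
      · exact ⟨_, hB.mono_left, (e.trans e').symm⟩
      · exact ⟨_, hC.mono_right, (e.trans e').symm⟩

theorem IsMonotoneMatching.lineDist_le (h g : ℕ → List α) {n m : ℕ} {A : ℕ → ℕ → Prop}
    (hA : IsMonotoneMatching n m A) : lineDist h g n m ≤ matchingCost h g n m A := by
  fun_induction lineDist h g n m generalizing A with
  | case1 => exact Nat.zero_le _
  | case2 n ih =>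
    have hn : ∀ x, ¬ A n x := fun x hx => absurd (hA.lt_right hx) (Nat.not_lt_zero _)
    rw [matchingCost_succ_left hn]
    exact Nat.add_le_add_right (ih (hA.of_row_empty hn)) _
  | case3 m ih =>
    have hm : ∀ y, ¬ A y m := fun y hy => absurd (hA.lt_left hy) (Nat.not_lt_zero _)
    rw [matchingCost_succ_right hm]
    exact Nat.add_le_add_right (ih (hA.of_col_empty hm)) _
  | case4 n m ih1 ih2 ih3 =>
    by_cases hnm : A n m
    · have hB := hA.erase hnm
      have e : A = fun y x => (A y x ∧ ¬ (y = n ∧ x = m)) ∨ (y = n ∧ x = m) := by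
        ext y x
        grind
      have := ih1 hB
      rw [e, matchingCost_insert hB]
      omega
    · by_cases hn : ∀ x, ¬ A n x
      · rw [matchingCost_succ_left hn]
        exact ((min_le_right _ _).trans (min_le_left _ _)).trans
          (Nat.add_le_add_right (ih2 (hA.of_row_empty hn)) _)
      · have hm : ∀ y, ¬ A y m := by
          push Not at hn
          obtain ⟨x, hx⟩ := hn
          obtain ⟨h1, h2, h3, h4, h5⟩ := hA
          grind
        rw [matchingCost_succ_right hm]
        exact ((min_le_right _ _).trans (min_le_right _ _)).trans
          (Nat.add_le_add_right (ih3 (hA.of_col_empty hm)) _)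

theorem lineDist_congr {h h' g g' : ℕ → List α} {n m : ℕ} (hh : ∀ y < n, h y = h' y)
    (hg : ∀ x < m, g x = g' x) : lineDist h g n m = lineDist h' g' n m := by
  fun_induction lineDist h g n m with
  | case1 => simp [lineDist]
  | case2 n ih => simp only [lineDist]; grind
  | case3 m ih => simp only [lineDist]; grind
  | case4 n m ih1 ih2 ih3 => simp only [lineDist]; grind

theorem costA_eq_matchingCost {H G : List (List α)} (B : ℕ → ℕ → Prop)
    (A : Fin H.length → Fin G.length → Bool) (hB : IsMonotoneMatching H.length G.length B)
    (hAB : ∀ y x, A y x = true ↔ B y x) :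
    costA H G A = matchingCost (fun i => H.getD i []) (fun i => G.getD i [])
      H.length G.length B := by
  have r : ∀ y : Fin H.length, (∀ x, ¬ A y x = true) ↔ ∀ x, ¬ B y x := fun y =>
    ⟨fun H x hx => H ⟨x, hB.lt_right hx⟩ ((hAB _ _).2 hx), fun H x hx => H x ((hAB _ _).1 hx)⟩
  have c : ∀ x : Fin G.length, (∀ y, ¬ A y x = true) ↔ ∀ y, ¬ B y x := fun x =>
    ⟨fun H y hy => H ⟨y, hB.lt_left hy⟩ ((hAB _ _).2 hy), fun H y hy => H y ((hAB _ _).1 hy)⟩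
  unfold costA matchingCost
  rw [Fintype.sum_prod_type, Finset.sum_range, Finset.sum_range, Finset.sum_range]
  simp only [r, c]
  simp only [Finset.sum_range, hAB]
  simp

theorem LDR_eq_lineDist (H G : List (List α)) :
    LDR H G = lineDist (fun i => H.getD i []) (fun i => G.getD i []) H.length G.length := by
  apply le_antisymm
  · obtain ⟨B, hB, e⟩ := exists_matchingCost_eq (fun i => H.getD i []) (fun i => G.getD i [])
      H.length G.length
    refine Nat.sInf_le ⟨fun y x => decide (B y x), ⟨?_, ?_⟩, ?_, ?_⟩
    · intro y x x' h1 h2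
      exact Fin.ext (hB.left_unique (of_decide_eq_true h1) (of_decide_eq_true h2))
    · intro y y' x h1 h2
      exact Fin.ext (hB.right_unique (of_decide_eq_true h1) (of_decide_eq_true h2))
    · intro y y' x x' h1 h2 h3
      exact hB.mono (of_decide_eq_true h1) (of_decide_eq_true h2) h3
    · rw [← e, costA_eq_matchingCost B _ hB]
      simp
  · refine le_csInf ⟨_, fun _ _ => false, ⟨by simp, by simp⟩, by simp [ReadOrder], rfl⟩ ?_
    rintro _ ⟨A, ⟨h1, h2⟩, h3, rfl⟩
    have hB : IsMonotoneMatching H.length G.length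
        (fun y x => ∃ (hy : y < H.length) (hx : x < G.length), A ⟨y, hy⟩ ⟨x, hx⟩ = true) := by
      constructor
      · rintro y x ⟨hy, -⟩
        exact hy
      · rintro y x ⟨-, hx, -⟩
        exact hx
      · rintro y x x' ⟨_, _, e⟩ ⟨_, _, e'⟩
        simpa using h1 _ _ _ e e'
      · rintro y y' x ⟨_, _, e⟩ ⟨_, _, e'⟩
        simpa using h2 _ _ _ e e'
      · rintro y y' x x' ⟨_, _, e⟩ ⟨_, _, e'⟩ hlt
        simpa using h3 _ _ _ _ e e' (by simpa using hlt)
    rw [costA_eq_matchingCost _ A hB (fun y x => by simp)]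
    exact hB.lineDist_le _ _

end Matching

/-- The position of the separator of `flat H` preceding the line of index `n`. -/
def sepPos {α : Type*} (H : List (List α)) (n : ℕ) : ℕ :=
  (flat (H.take n)).length

section Separators

variable {α : Type*} {H : List (List α)} {n q : ℕ}

theorem flat_append (P Q : List (List α)) :
    flat (P ++ Q) = flat P ++ Q.flatMap (fun l => l.map some ++ [none]) := by
  simp [flat]

theorem sepPos_zero (H : List (List α)) : sepPos H 0 = 1 := by
  simp [sepPos, flat]

theorem sepPos_pos (H : List (List α)) (n : ℕ) : 0 < sepPos H n := by
  simp [sepPos, flat]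

theorem sepPos_succ (hn : n < H.length) :
    sepPos H (n + 1) = sepPos H n + (H.getD n []).length + 1 := by
  simp only [sepPos]
  rw [List.take_succ_eq_append_getElem hn, flat_append]
  simp [hn, add_assoc]

theorem flat_eq_take_append (hn : n < H.length) :
    flat H = flat (H.take n) ++ ((H.getD n []).map some ++ none ::
      (H.drop (n + 1)).flatMap (fun l => l.map some ++ [none])) := by
  conv_lhs => rw [← List.take_append_drop n H, flat_append, List.drop_eq_getElem_cons hn,
    List.flatMap_cons]
  simp [hn]

theorem nth_sepPos_add (hn : n < H.length) (hq : q < (H.getD n []).length) :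
    nth (flat H) (sepPos H n + q + 1) = some ((H.getD n [])[q]) := by
  rw [flat_eq_take_append hn, nth, sepPos, Nat.add_sub_cancel,
    List.getD_append_right _ _ _ _ (by omega),
    Nat.add_sub_cancel_left, List.getD_append _ _ _ _ (by simpa using hq)]
  rw [List.getD_eq_getElem _ _ (by simpa using hq)]
  simp

theorem flat_take_sepPos (H : List (List α)) (n : ℕ) :
    (flat H).take (sepPos H n) = flat (H.take n) := by
  conv_lhs => rw [← List.take_append_drop n H, flat_append]
  rw [sepPos, List.take_append_drop, List.take_left]

theorem sepPos_le (H : List (List α)) (n : ℕ) : sepPos H n ≤ (flat H).length := by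
  have := congrArg List.length (flat_take_sepPos H n)
  rw [List.length_take, ← sepPos] at this
  omega

theorem nth_sepPos (hn : n ≤ H.length) : nth (flat H) (sepPos H n) = none := by
  cases n with
  | zero => simp [sepPos_zero, nth, flat]
  | succ n =>
    rw [sepPos_succ hn, nth, flat_eq_take_append hn, Nat.add_sub_cancel, sepPos,
      List.getD_append_right _ _ _ _ (by omega), Nat.add_sub_cancel_left,
      List.getD_append_right _ _ _ _ (by simp)]
    simp

theorem isBrk_sepPos (hn : n ≤ H.length) : isBrk (flat H) (sepPos H n) :=
  ⟨sepPos_pos H n, sepPos_le H n, nth_sepPos hn⟩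

theorem prevBrk_sepPos_succ (hn : n < H.length) :
    prevBrk (flat H) (sepPos H (n + 1)) = sepPos H n := by
  rw [prevBrk, sepPos_succ hn, Nat.add_sub_cancel, Nat.findGreatest_eq_iff]
  refine ⟨by omega, fun _ => isBrk_sepPos hn.le, ?_⟩
  intro k hk hk' hb
  obtain ⟨q, rfl⟩ := Nat.exists_eq_add_of_lt hk
  have := hb.2.2
  rw [nth_sepPos_add hn (by omega)] at this
  cases this

theorem brkIdx_eq_countP (h : List (Option α)) {i : ℕ} (hi : i ≤ h.length) :
    brkIdx h i = (h.take i).countP Option.isNone := by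
  induction i with
  | zero => simp [brkIdx]
  | succ i ih =>
    have ih := ih (by omega)
    rw [brkIdx] at ih ⊢
    rw [List.range_succ, List.filter_append, List.length_append, ih,
      List.take_succ_eq_append_getElem (by omega), List.countP_append]
    congr 1
    have e : nth h (i + 1) = h[i] := by
      rw [nth, Nat.add_sub_cancel, List.getD_eq_getElem]
    by_cases hb : h[i] = none
    · have : isBrk h (i + 1) := ⟨by omega, hi, e.trans hb⟩
      simp [this, hb]
    · have : ¬ isBrk h (i + 1) := fun H => hb (e.symm.trans H.2.2)
      simp [this, hb]

theorem countP_isNone_flat (H : List (List α)) :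
    (flat H).countP Option.isNone = H.length + 1 := by
  induction H using List.reverseRecOn with
  | nil => simp [flat]
  | append_singleton H l ih =>
    rw [flat_append, List.countP_append, ih]
    simp [List.countP_map, Function.comp_def]

theorem brkIdx_sepPos (hn : n ≤ H.length) : brkIdx (flat H) (sepPos H n) = n + 1 := by
  rw [brkIdx_eq_countP _ (sepPos_le H n), flat_take_sepPos H n, countP_isNone_flat]
  simp [hn]

end Separators

section DynamicProgram

variable {α : Type*} {H G : List (List α)}

theorem DR_of_not_isBrk {i j : ℕ}
    (hb : ¬ (isBrk (flat H) (i + 1) ∧ isBrk (flat G) (j + 1))) :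
    DR H G (i + 1) (j + 1) = min (DR H G i j + dR (flat H) (flat G) (i + 1) (j + 1)) (min
        (if nth (flat H) (i + 1) ≠ none then DR H G i (j + 1) + 1 else ⊤)
        (if nth (flat G) (j + 1) ≠ none then DR H G (i + 1) j + 1 else ⊤)) := by
  rw [DR, if_neg hb]

theorem DR_of_isBrk {i j : ℕ} (hi : isBrk (flat H) (i + 1)) (hj : isBrk (flat G) (j + 1)) :
    DR H G (i + 1) (j + 1) = min (DR H G i j) (min
        (if 2 ≤ brkIdx (flat H) (i + 1) then
            DR H G (prevBrk (flat H) (i + 1)) (j + 1)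
              + ((H.getD (brkIdx (flat H) (i + 1) - 2) []).length : ℕ∞)
          else ⊤)
        (if 2 ≤ brkIdx (flat G) (j + 1) then
            DR H G (i + 1) (prevBrk (flat G) (j + 1))
              + ((G.getD (brkIdx (flat G) (j + 1) - 2) []).length : ℕ∞)
          else ⊤)) := by
  rw [DR, if_pos ⟨hi, hj⟩]

theorem DR_char_char {i j : ℕ} {u v : α} (hi : nth (flat H) (i + 1) = some u)
    (hj : nth (flat G) (j + 1) = some v) :
    DR H G (i + 1) (j + 1) = min (DR H G i j + if u = v then 0 else 1)
      (min (DR H G i (j + 1) + 1) (DR H G (i + 1) j + 1)) := by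
  rw [DR_of_not_isBrk (fun hb => by simp [hb.1.2.2] at hi)]
  simp [hi, hj, dR]

theorem DR_char_sep {i j : ℕ} {u : α} (hi : nth (flat H) (i + 1) = some u)
    (hj : nth (flat G) (j + 1) = none) :
    DR H G (i + 1) (j + 1) = DR H G i (j + 1) + 1 := by
  rw [DR_of_not_isBrk (fun hb => by simp [hb.1.2.2] at hi)]
  simp [hi, hj, dR]

theorem DR_sep_char {i j : ℕ} {v : α} (hi : nth (flat H) (i + 1) = none)
    (hj : nth (flat G) (j + 1) = some v) :
    DR H G (i + 1) (j + 1) = DR H G (i + 1) j + 1 := by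
  rw [DR_of_not_isBrk (fun hb => by simp [hb.2.2.2] at hj)]
  simp [hi, hj, dR]

theorem DR_zero_left (j : ℕ) : DR H G 0 j = j := by
  cases j <;> simp [DR]

theorem DR_zero_right (i : ℕ) : DR H G i 0 = i := by
  cases i <;> simp [DR]

variable [DecidableEq α]

theorem min_add_natCast (d : ℕ∞) (a a' b b' c c' : ℕ) :
    min (d + a + a') (min (d + b + b') (d + c + c'))
      = d + (min (a + a') (min (b + b') (c + c')) : ℕ) := by
  induction d using ENat.recTopCoe with
  | top => simp
  | coe d =>
    simp only [← Nat.cast_add, ← Nat.mono_cast.map_min]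
    congr 1
    omega

theorem DR_sepPos_add {n m p q : ℕ} (hn : n < H.length) (hm : m < G.length)
    (hp : p ≤ (H.getD n []).length) (hq : q ≤ (G.getD m []).length) :
    DR H G (sepPos H n + p) (sepPos G m + q) = DR H G (sepPos H n) (sepPos G m)
      + (lev ((H.getD n []).take p) ((G.getD m []).take q) : ℕ) := by
  obtain ⟨i, hi⟩ := Nat.exists_eq_add_one.2 (sepPos_pos H n)
  obtain ⟨j, hj⟩ := Nat.exists_eq_add_one.2 (sepPos_pos G m)
  induction p generalizing q with
  | zero =>
    induction q with
    | zero => simp [lev_nil_left]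
    | succ q ihq =>
      have e := ihq (by omega)
      have := DR_sep_char (hi ▸ nth_sepPos hn.le) (nth_sepPos_add hm hq)
      rw [← hi] at this
      rw [add_zero] at e ⊢
      rw [← add_assoc, this, e, List.take_zero, lev_nil_left, lev_nil_left, List.length_take,
        List.length_take, min_eq_left hq, min_eq_left (Nat.le_of_succ_le hq), add_assoc, Nat.cast_succ]
  | succ p ihp =>
    induction q with
    | zero =>
      have e := ihp (q := 0) (by omega) (by omega)
      have := DR_char_sep (nth_sepPos_add hn hp) (hj ▸ nth_sepPos hm.le)
      rw [← hj] at this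
      rw [add_zero] at e ⊢
      rw [← add_assoc, this, e, List.take_zero, lev_nil_right, lev_nil_right, List.length_take,
        List.length_take, min_eq_left hp, min_eq_left (Nat.le_of_succ_le hp), add_assoc, Nat.cast_succ]
    | succ q ihq =>
      have e1 := ihp (q := q) (by omega) (by omega)
      have e2 := ihp (q := q + 1) (by omega) hq
      have e3 := ihq (by omega)
      have := DR_char_char (nth_sepPos_add hn hp) (nth_sepPos_add hm hq)
      rw [← add_assoc] at e2 e3
      rw [← add_assoc, ← add_assoc, this, e1, e2, e3]
      rw [List.take_succ_eq_append_getElem hp, List.take_succ_eq_append_getElem hq,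
        lev_concat_concat]
      split_ifs
      · exact_mod_cast min_add_natCast _ _ 0 _ 1 _ 1
      · exact_mod_cast min_add_natCast _ _ 1 _ 1 _ 1

theorem lineDist_zero_left_lt {m : ℕ} (h : ℕ → List α) (hm : m ≤ G.length) :
    lineDist h (fun i => G.getD i []) 0 m < sepPos G m := by
  induction m with
  | zero => simp [lineDist, sepPos_zero]
  | succ m ih =>
    have := ih (by omega)
    rw [lineDist, sepPos_succ hm]
    omega

theorem lineDist_zero_right_lt {n : ℕ} (g : ℕ → List α) (hn : n ≤ H.length) :
    lineDist (fun i => H.getD i []) g n 0 < sepPos H n := by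
  induction n with
  | zero => simp [lineDist, sepPos_zero]
  | succ n ih =>
    have := ih (by omega)
    rw [lineDist, sepPos_succ hn]
    omega

theorem DR_sepPos {n m : ℕ} (hn : n ≤ H.length) (hm : m ≤ G.length) :
    DR H G (sepPos H n) (sepPos G m)
      = (lineDist (fun i => H.getD i []) (fun i => G.getD i []) n m : ℕ) := by
  induction n generalizing m with
  | zero =>
    induction m with
    | zero =>
      have h0 := isBrk_sepPos (H := H) (Nat.zero_le _)
      have g0 := isBrk_sepPos (H := G) (Nat.zero_le _)
      have hb := brkIdx_sepPos (H := H) (Nat.zero_le _)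
      have gb := brkIdx_sepPos (H := G) (Nat.zero_le _)
      rw [sepPos_zero] at h0 g0 hb gb
      rw [sepPos_zero, sepPos_zero, DR_of_isBrk h0 g0, hb, gb]
      simp [lineDist, DR_zero_left]
    | succ m ih =>
      have h0 := isBrk_sepPos (H := H) (Nat.zero_le _)
      have hb := brkIdx_sepPos (H := H) (Nat.zero_le _)
      have gj := isBrk_sepPos hm
      have gb := brkIdx_sepPos hm
      have gp := prevBrk_sepPos_succ (H := G) hm
      have e := ih (by omega)
      have hlt := lineDist_zero_left_lt (G := G) (m := m) (fun i => H.getD i []) (by omega)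
      rw [sepPos_succ hm] at gj gb gp ⊢
      rw [sepPos_zero] at h0 hb e ⊢
      rw [DR_of_isBrk h0 gj, hb, gb, gp, zero_add, e, DR_zero_left, lineDist]
      simp [-List.getD_eq_getElem?_getD]
      omega
  | succ n ihn =>
    have h1 := isBrk_sepPos hn
    have hb := brkIdx_sepPos hn
    have hp := prevBrk_sepPos_succ (H := H) hn
    induction m with
    | zero =>
      have g0 := isBrk_sepPos (H := G) (Nat.zero_le _)
      have gb := brkIdx_sepPos (H := G) (Nat.zero_le _)
      have e := ihn (m := 0) (by omega) (by omega)
      have hlt := lineDist_zero_right_lt (H := H) (n := n) (fun i => G.getD i []) (by omega)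
      rw [sepPos_succ hn] at h1 hb hp ⊢
      rw [sepPos_zero] at g0 gb e ⊢
      rw [DR_of_isBrk h1 g0, hb, gb, hp, zero_add, e, DR_zero_right, lineDist]
      simp [-List.getD_eq_getElem?_getD]
      omega
    | succ m ihm =>
      have gj := isBrk_sepPos hm
      have gb := brkIdx_sepPos hm
      have gp := prevBrk_sepPos_succ (H := G) hm
      have e1 := ihn (m := m) (by omega) (by omega)
      have e2 := ihn (by omega) hm
      have e3 := ihm (by omega)
      have d := DR_sepPos_add hn hm le_rfl le_rfl
      rw [sepPos_succ hn] at h1 hb hp e3 ⊢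
      rw [sepPos_succ hm] at gj gb gp e2 ⊢
      rw [DR_of_isBrk h1 gj, hb, gb, hp, gp, d, e1, e2, e3, List.take_length, List.take_length,
        lineDist, Nat.mono_cast.map_min, Nat.mono_cast.map_min]
      simp

end DynamicProgram

/-- For nonempty tuples `H = H' ++ (H_N)` and `G = G' ++ (G_M)` with flattened
sequences `h = f(H)`, `g = f(G)`, the dynamic program decomposes at the penultimate
separators: `D^R(|h|−1, |g|−1) = LD^R(H',G') + LD(H_N, G_M)`. -/
theorem DR_penultimate {α : Type*} [DecidableEq α]
    (H' G' : List (List α)) (a b : List α) :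
    DR (H' ++ [a]) (G' ++ [b])
        ((flat (H' ++ [a])).length - 1) ((flat (G' ++ [b])).length - 1)
      = ((LDR H' G' + lev a b : ℕ) : ℕ∞) := by
  have key : ∀ (P : List (List α)) (l : List α),
      (flat (P ++ [l])).length - 1 = sepPos (P ++ [l]) P.length + l.length := by
    intro P l
    rw [sepPos, List.take_left, flat_append]
    simp [← add_assoc]
  have d := DR_sepPos_add (H := H' ++ [a]) (G := G' ++ [b]) (n := H'.length) (m := G'.length)
    (by simp) (by simp) le_rfl le_rfl
  rw [DR_sepPos (by simp) (by simp), List.take_length, List.take_length] at d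
  simp only [List.getD_append_right _ _ _ _ le_rfl, Nat.sub_self, List.getD_cons_zero] at d
  rw [key, key, d, LDR_eq_lineDist]
  push_cast
  congr 2
  apply lineDist_congr
  · exact fun y hy => List.getD_append _ _ _ _ hy
  · exact fun x hx => List.getD_append _ _ _ _ hx
end

section
/- Let Φ* ∈ Ψ attain the minimum LD^S(H,G) = min over Φ ∈ Ψ of LD(Φ(H),G), and let A be an assignment matrix attaining LD(Φ*(H),G). Then no unmatched hypothesis line contains a space: for every y ∈ U(A), the line (Φ*(H))_y contains no occurrence of ␣. -/
/-- `LD(H,G)`: the minimum of the cost over all valid assignment matrices. -/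
noncomputable def LDt {α : Type*} [DecidableEq α] (H G : List (List α)) : ℕ :=
  sInf {c : ℕ | ∃ A : Fin H.length → Fin G.length → Bool, ValidA A ∧ c = costA H G A}

/-- A single split or merge operation on a tuple of lines (`sp` is the space `␣`). -/
inductive SegStep {α : Type*} (sp : α) : List (List α) → List (List α) → Prop
  | split (pre : List (List α)) (u v : List α) (post : List (List α)) :
      SegStep sp (pre ++ [u ++ [sp] ++ v] ++ post) (pre ++ [u, v] ++ post)
  | merge (pre : List (List α)) (u v : List α) (post : List (List α)) :
      SegStep sp (pre ++ [u, v] ++ post) (pre ++ [u ++ [sp] ++ v] ++ post)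

/-- Dropping a space from an unmatched line by splitting it in two lowers the cost by one. Here
`e` identifies the lines of `K` with those of `H` plus one extra line. -/
theorem exists_costA_add_one_of_equiv {α : Type*} [DecidableEq α] {H K G : List (List α)}
    {A : Fin H.length → Fin G.length → Bool} (hA : ValidA A)
    (e : Option (Fin H.length) ≃ Fin K.length) (y₀ : Fin H.length)
    (hy₀ : ∀ x, ¬ A y₀ x = true)
    (hlen : (K.get (e none)).length + (K.get (e (some y₀))).length + 1 = (H.get y₀).length)
    (hget : ∀ y, y ≠ y₀ → K.get (e (some y)) = H.get y) :
    ∃ B : Fin K.length → Fin G.length → Bool, ValidA B ∧ costA K G B + 1 = costA H G A := by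
  let B' : Option (Fin H.length) → Fin G.length → Bool := fun o x => o.elim false fun y => A y x
  refine ⟨fun j => B' (e.symm j), ⟨fun j x x' h h' => ?_, fun j j' x h h' => ?_⟩, ?_⟩
  · rcases ho : e.symm j with _ | y
    · simp [B', ho] at h
    · exact hA.1 y x x' (by simpa [B', ho] using h) (by simpa [B', ho] using h')
  · rcases ho : e.symm j with _ | y
    · simp [B', ho] at h
    rcases ho' : e.symm j' with _ | y'
    · simp [B', ho'] at h'
    apply e.symm.injective
    rw [ho, ho', hA.2 y y' x (by simpa [B', ho] using h) (by simpa [B', ho'] using h')]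
  · have hmatched : (∑ p : Fin K.length × Fin G.length,
        if B' (e.symm p.1) p.2 = true then lev (K.get p.1) (G.get p.2) else 0) =
        ∑ p : Fin H.length × Fin G.length,
          if A p.1 p.2 = true then lev (H.get p.1) (G.get p.2) else 0 := by
      rw [Fintype.sum_prod_type, Fintype.sum_prod_type, ← e.sum_comp, Fintype.sum_option]
      simp only [Equiv.symm_apply_apply, B', Option.elim_none, Option.elim_some,
        Bool.false_eq_true, if_false, Finset.sum_const_zero, zero_add]
      refine Finset.sum_congr rfl fun y _ => Finset.sum_congr rfl fun x _ => ?_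
      by_cases hy : y = y₀
      · subst hy
        rw [if_neg (hy₀ x), if_neg (hy₀ x)]
      · rw [hget y hy]
    have hrows : (∑ j : Fin K.length,
        if ∀ x, ¬ B' (e.symm j) x = true then (K.get j).length else 0) + 1 =
        ∑ y : Fin H.length, if ∀ x, ¬ A y x = true then (H.get y).length else 0 := by
      rw [← e.sum_comp, Fintype.sum_option, ← Finset.add_sum_erase _ _ (Finset.mem_univ y₀),
        ← Finset.add_sum_erase (a := y₀) Finset.univ
          (fun y => if ∀ x, ¬ A y x = true then (H.get y).length else 0) (Finset.mem_univ y₀)]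
      have hrest : ∀ y ∈ Finset.univ.erase y₀,
          (if ∀ x, ¬ A y x = true then (K.get (e (some y))).length else 0) =
          if ∀ x, ¬ A y x = true then (H.get y).length else 0 := fun y hy => by
        rw [hget y (Finset.ne_of_mem_erase hy)]
      simp only [Equiv.symm_apply_apply, B', Option.elim_none, Option.elim_some,
        Bool.false_eq_true, not_false_eq_true, implies_true, if_true]
      rw [Finset.sum_congr rfl hrest, if_pos hy₀, if_pos hy₀]
      omega
    have hcols : ∀ x, (∀ j, ¬ B' (e.symm j) x = true) ↔ ∀ y, ¬ A y x = true := fun x => by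
      rw [← e.forall_congr_right, Option.forall]
      simp [B']
    unfold costA
    rw [hmatched, ← hrows]
    simp only [hcols]
    omega

/-- Splitting an unmatched line at a space yields an assignment that is cheaper by one. -/
theorem exists_costA_add_one_of_split {α : Type*} [DecidableEq α] (sp : α)
    (pre post G : List (List α)) (u v : List α)
    {A : Fin (pre ++ [u ++ [sp] ++ v] ++ post).length → Fin G.length → Bool} (hA : ValidA A)
    (y : Fin (pre ++ [u ++ [sp] ++ v] ++ post).length) (hy : y.val = pre.length)
    (hunmatched : ∀ x, ¬ A y x = true) :
    ∃ B : Fin (pre ++ [u, v] ++ post).length → Fin G.length → Bool,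
      ValidA B ∧
        costA (pre ++ [u, v] ++ post) G B + 1 = costA (pre ++ [u ++ [sp] ++ v] ++ post) G A := by
  have hlen : (pre ++ [u ++ [sp] ++ v] ++ post).length + 1 = (pre ++ [u, v] ++ post).length := by
    simp; omega
  refine exists_costA_add_one_of_equiv hA
    ((finSuccEquiv' y.succ).symm.trans (finCongr hlen)) y hunmatched ?_ fun z hz => ?_
  · simp [Fin.succAbove, Fin.lt_def, hy]
    omega
  · have hz' : z.val ≠ pre.length := fun h => hz (Fin.ext (h.trans hy.symm))
    have hzlt := z.isLt
    simp only [Equiv.trans_apply, finSuccEquiv'_symm_some, finCongr_apply, List.get_eq_getElem,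
      Fin.val_cast, Fin.succAbove, Fin.lt_def, Fin.val_castSucc, Fin.val_succ, hy]
    rcases lt_or_gt_of_ne hz' with h | h
    · simp [h, h.trans (Nat.lt_succ_self _)]
    · simp only [List.getElem_append]
      grind

/-- Let `Φ* ∈ Ψ` attain the minimum `LD^S(H,G) = min_{Φ ∈ Ψ} LD(Φ(H),G)`
(`Hstar = Φ*(H)`), and let `A` be an assignment matrix attaining `LD(Φ*(H),G)`.  Then no
unmatched hypothesis line contains a space: for every `y ∈ U(A)`, the line `(Φ*(H))_y`
contains no occurrence of `␣`. -/
theorem unmatched_line_has_no_space {α : Type*} [DecidableEq α] (sp : α)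
    (H G Hstar : List (List α))
    (hH : ∀ l ∈ H, l.head? ≠ some sp ∧ l.getLast? ≠ some sp)
    (hG : ∀ l ∈ G, l.head? ≠ some sp ∧ l.getLast? ≠ some sp)
    (hreach : Relation.ReflTransGen (SegStep sp) H Hstar)
    (hopt : ∀ H', Relation.ReflTransGen (SegStep sp) H H' → LDt Hstar G ≤ LDt H' G)
    (A : Fin Hstar.length → Fin G.length → Bool)
    (hA : ValidA A) (hAopt : costA Hstar G A = LDt Hstar G) :
    ∀ y : Fin Hstar.length, (∀ x, ¬ A y x = true) → sp ∉ Hstar.get y := by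
  intro y hy hmem
  obtain ⟨u, v, huv⟩ := List.append_of_mem hmem
  obtain ⟨pre, post, hsplit, hpre⟩ : ∃ pre post : List (List α),
      Hstar = pre ++ [u ++ [sp] ++ v] ++ post ∧ y.val = pre.length := by
    refine ⟨Hstar.take y, Hstar.drop (y + 1), ?_, by simp [y.isLt.le]⟩
    have hline : u ++ [sp] ++ v = Hstar[y.val] := by simpa using huv.symm
    rw [hline]
    simp
  subst hsplit
  obtain ⟨B, hB, hcost⟩ := exists_costA_add_one_of_split sp pre post G u v hA y hpre hy
  have hle := hopt _ (hreach.tail (SegStep.split pre u v post))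
  have hLDt : LDt (pre ++ [u, v] ++ post) G ≤ costA (pre ++ [u, v] ++ post) G B :=
    Nat.sInf_le ⟨B, hB, rfl⟩
  omega
end

section
/- Let h be a single line with no leading or trailing space and no two consecutive spaces. Over all compositions Φ ∈ Ψ of split and merge operations applied to the one-line tuple (h), the minimal total length Σ_y |(Φ((h)))_y| of the resulting lines equals the number of non-space characters of h, and this minimum is attained by splitting h at every space into its words. -/
/-- `Φ ∈ Ψ` applied to `H`: the tuples reachable from `H` by a finite composition of split
and merge operations (including the identity) are exactly those related to `H` by the
reflexive-transitive closure of `SegStep sp`. -/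
def Reseg {α : Type*} (sp : α) : List (List α) → List (List α) → Prop :=
  Relation.ReflTransGen (SegStep sp)

theorem List.not_mem_of_mem_splitOn {α : Type*} [DecidableEq α] (a : α) (xs : List α) :
    ∀ l ∈ xs.splitOn a, a ∉ l := by
  induction xs with
  | nil => simp
  | cons x xs ih =>
    rw [List.splitOn_cons_eq_if_modifyHead]
    split_ifs with hx
    · simpa using ih
    · obtain ⟨l, ls, hl⟩ := List.exists_cons_of_ne_nil (List.splitOn_ne_nil a xs)
      rw [hl] at ih ⊢
      have hxa : a ≠ x := fun e => hx (by simp [e])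
      simpa [hxa] using ih

theorem Reseg.filter_flatten_eq {α : Type*} [DecidableEq α] {sp : α} {H T : List (List α)}
    (hT : Reseg sp H T) :
    T.flatten.filter (fun c => c ≠ sp) = H.flatten.filter (fun c => c ≠ sp) := by
  induction hT with
  | refl => rfl
  | tail _ hstep ih =>
    rw [← ih]
    cases hstep <;> simp

theorem Reseg.of_intercalate {α : Type*} (sp : α) (L : List (List α)) (hL : L ≠ [])
    (pre : List (List α)) : Reseg sp (pre ++ [[sp].intercalate L]) (pre ++ L) := by
  induction L generalizing pre with
  | nil => exact absurd rfl hL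
  | cons u L ih =>
    by_cases hnil : L = []
    · subst hnil
      rw [List.intercalate_singleton]
      exact Relation.ReflTransGen.refl
    · have hstep := SegStep.split (sp := sp) pre u ([sp].intercalate L) []
      have hrest := ih hnil (pre ++ [u])
      rw [List.intercalate_cons_of_ne_nil hnil]
      simp only [List.append_nil, List.append_assoc, List.singleton_append] at hstep hrest ⊢
      exact Relation.ReflTransGen.head hstep hrest

theorem Reseg.splitOn {α : Type*} [DecidableEq α] (sp : α) (h : List α) :
    Reseg sp [h] (h.splitOn sp) := by
  simpa [List.intercalate_splitOn] using
    Reseg.of_intercalate sp (h.splitOn sp) (List.splitOn_ne_nil sp h) []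

theorem List.sum_length_splitOn {α : Type*} [DecidableEq α] (sp : α) (h : List α) :
    ((h.splitOn sp).map List.length).sum = (h.filter (fun c => c ≠ sp)).length := by
  have hfilter := (Reseg.splitOn sp h).filter_flatten_eq
  rw [List.flatten_singleton, List.filter_eq_self.2] at hfilter
  · rw [← hfilter, List.length_flatten]
  · intro c hc
    obtain ⟨l, hl, hcl⟩ := List.mem_flatten.1 hc
    simpa using fun e : c = sp => List.not_mem_of_mem_splitOn sp h l hl (e ▸ hcl)

/-- Let `h` be a single line with no leading or trailing space and no two
consecutive spaces.  Over all compositions `Φ ∈ Ψ` of split and merge operations applied to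
the one-line tuple `(h)`, the minimal total length `Σ_y |(Φ((h)))_y|` of the resulting lines
equals the number of non-space characters of `h`, and this minimum is attained by splitting
`h` at every space into its words. -/
theorem min_total_length_eq_nonspace_count {α : Type*} [DecidableEq α] (sp : α) (h : List α)
    (hhead : h.head? ≠ some sp) (hlast : h.getLast? ≠ some sp)
    (hconsec : ¬ [sp, sp] <:+: h) :
    sInf {c : ℕ | ∃ T : List (List α), Reseg sp [h] T ∧ c = (T.map List.length).sum}
        = (h.filter (fun c => c ≠ sp)).length
    ∧ Reseg sp [h] (h.splitOn sp)
    ∧ ((h.splitOn sp).map List.length).sum = (h.filter (fun c => c ≠ sp)).length := by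
  refine ⟨IsLeast.csInf_eq ⟨⟨_, Reseg.splitOn sp h, (List.sum_length_splitOn sp h).symm⟩, ?_⟩,
    Reseg.splitOn sp h, List.sum_length_splitOn sp h⟩
  rintro c ⟨T, hT, rfl⟩
  have hfilter := hT.filter_flatten_eq
  rw [List.flatten_singleton] at hfilter
  rw [← hfilter, ← List.length_flatten]
  exact List.length_filter_le _ _
end
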